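/- Suppose 0 < α < minᵢ λᵢ. Then the minimum of f_α on [0, minᵢ λᵢ) is attained at δ = α/2: for every δ with 0 ≤ δ < minᵢ λᵢ one has f_α(α/2) ≤ f_α(δ). -/

import Mathlib

open Matrix

/-- `W(δ) = U · diag(√(λᵢ − δ))`. -/
noncomputable def Wmat {M P : ℕ} (U : Matrix (Fin M) (Fin P) ℝ) (lam : Fin P → ℝ)
    (δ : ℝ) : Matrix (Fin M) (Fin P) ℝ :=
  U * Matrix.diagonal (fun i => Real.sqrt (lam i - δ))

/-- `ẑ(δ) = L⁻¹ · diag(√(λᵢ − δ)) · Uᵀ x`. -/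
noncomputable def zhat {M P : ℕ} (U : Matrix (Fin M) (Fin P) ℝ) (lam : Fin P → ℝ)
    (δ : ℝ) (x : Fin M → ℝ) : Fin P → ℝ :=
  ((Matrix.diagonal lam)⁻¹ * Matrix.diagonal (fun i => Real.sqrt (lam i - δ)) * Uᵀ).mulVec x

/-- Squared Euclidean norm on `ℝ^M`. -/
noncomputable def enormSq {M : ℕ} (v : Fin M → ℝ) : ℝ :=
  ‖(EuclideanSpace.equiv (Fin M) ℝ).symm v‖ ^ 2

/-- `f_α(δ) = (1/2)·(ẑ(δ)ᵀẑ(δ) + (1/α)·‖x − W(δ)ẑ(δ)‖²)`. -/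
noncomputable def fA {M P : ℕ} (U : Matrix (Fin M) (Fin P) ℝ) (lam : Fin P → ℝ)
    (x : Fin M → ℝ) (α δ : ℝ) : ℝ :=
  (1 / 2) * (zhat U lam δ x ⬝ᵥ zhat U lam δ x +
    (1 / α) * enormSq (x - (Wmat U lam δ).mulVec (zhat U lam δ x)))

theorem inv_diagonal_of_ne_zero {n : Type*} [Fintype n] [DecidableEq n] {d : n → ℝ}
    (hd : ∀ i, d i ≠ 0) :
    (Matrix.diagonal d)⁻¹ = Matrix.diagonal fun i => (d i)⁻¹ := by
  refine Matrix.inv_eq_right_inv ?_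
  simp [Matrix.diagonal_mul_diagonal, hd]

theorem zhat_apply {M P : ℕ} (U : Matrix (Fin M) (Fin P) ℝ) {lam : Fin P → ℝ}
    (hlam : ∀ i, 0 < lam i) (δ : ℝ) (x : Fin M → ℝ) (i : Fin P) :
    zhat U lam δ x i = (lam i)⁻¹ * Real.sqrt (lam i - δ) * (Uᵀ *ᵥ x) i := by
  rw [zhat, inv_diagonal_of_ne_zero fun i => (hlam i).ne', Matrix.diagonal_mul_diagonal,
    ← Matrix.mulVec_mulVec, Matrix.mulVec_diagonal]

theorem dotProduct_zhat_self {M P : ℕ} (U : Matrix (Fin M) (Fin P) ℝ) {lam : Fin P → ℝ}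
    (hlam : ∀ i, 0 < lam i) (x : Fin M → ℝ) {δ : ℝ} (hδ : ∀ i, δ < lam i) :
    zhat U lam δ x ⬝ᵥ zhat U lam δ x =
      ∑ i, (lam i - δ) * ((lam i)⁻¹ * (Uᵀ *ᵥ x) i) ^ 2 := by
  refine Finset.sum_congr rfl fun i _ => ?_
  rw [zhat_apply U hlam]
  linear_combination
    ((lam i)⁻¹ * (Uᵀ *ᵥ x) i) ^ 2 * Real.mul_self_sqrt (sub_nonneg.2 (hδ i).le)

theorem enormSq_eq_dotProduct {M : ℕ} (v : Fin M → ℝ) : enormSq v = v ⬝ᵥ v := by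
  rw [enormSq, EuclideanSpace.norm_sq_eq]
  simp [dotProduct, sq]

theorem enormSq_sub_mulVec {M P : ℕ} {U : Matrix (Fin M) (Fin P) ℝ} (hU : Uᵀ * U = 1)
    (x : Fin M → ℝ) (w : Fin P → ℝ) :
    enormSq (x - U *ᵥ w) =
      x ⬝ᵥ x - (Uᵀ *ᵥ x) ⬝ᵥ (Uᵀ *ᵥ x) + (Uᵀ *ᵥ x - w) ⬝ᵥ (Uᵀ *ᵥ x - w) := by
  have hcross : x ⬝ᵥ (U *ᵥ w) = (Uᵀ *ᵥ x) ⬝ᵥ w := by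
    rw [Matrix.dotProduct_mulVec, Matrix.mulVec_transpose]
  have hnorm : (U *ᵥ w) ⬝ᵥ (U *ᵥ w) = w ⬝ᵥ w := by
    rw [Matrix.dotProduct_mulVec, ← Matrix.mulVec_transpose, Matrix.mulVec_mulVec, hU,
      Matrix.one_mulVec]
  rw [enormSq_eq_dotProduct]
  simp only [sub_dotProduct, dotProduct_sub, dotProduct_comm (U *ᵥ w) x,
    dotProduct_comm w (Uᵀ *ᵥ x), hcross, hnorm]
  ring

theorem enormSq_residual {M P : ℕ} {U : Matrix (Fin M) (Fin P) ℝ} (hU : Uᵀ * U = 1)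
    {lam : Fin P → ℝ} (hlam : ∀ i, 0 < lam i) (x : Fin M → ℝ) {δ : ℝ} (hδ : ∀ i, δ < lam i) :
    enormSq (x - Wmat U lam δ *ᵥ zhat U lam δ x) =
      x ⬝ᵥ x - (Uᵀ *ᵥ x) ⬝ᵥ (Uᵀ *ᵥ x) +
        ∑ i, δ ^ 2 * ((lam i)⁻¹ * (Uᵀ *ᵥ x) i) ^ 2 := by
  rw [Wmat, ← Matrix.mulVec_mulVec, enormSq_sub_mulVec hU]
  congr 1
  refine Finset.sum_congr rfl fun i _ => ?_
  have hres : (Uᵀ *ᵥ x - Matrix.diagonal (fun i => Real.sqrt (lam i - δ)) *ᵥ zhat U lam δ x) i =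
      δ * ((lam i)⁻¹ * (Uᵀ *ᵥ x) i) := by
    rw [Pi.sub_apply, Matrix.mulVec_diagonal, zhat_apply U hlam]
    linear_combination
      -((lam i)⁻¹ * (Uᵀ *ᵥ x) i) * Real.mul_self_sqrt (sub_nonneg.2 (hδ i).le) -
        (Uᵀ *ᵥ x) i * inv_mul_cancel₀ (hlam i).ne'
  rw [hres]
  ring

theorem fA_eq {M P : ℕ} {U : Matrix (Fin M) (Fin P) ℝ} (hU : Uᵀ * U = 1)
    {lam : Fin P → ℝ} (hlam : ∀ i, 0 < lam i) (x : Fin M → ℝ) {α δ : ℝ} (hδ : ∀ i, δ < lam i) :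
    fA U lam x α δ = (1 / 2) *
      (∑ i, (lam i - δ + (1 / α) * δ ^ 2) * ((lam i)⁻¹ * (Uᵀ *ᵥ x) i) ^ 2 +
        (1 / α) * (x ⬝ᵥ x - (Uᵀ *ᵥ x) ⬝ᵥ (Uᵀ *ᵥ x))) := by
  rw [fA, dotProduct_zhat_self U hlam x hδ, enormSq_residual hU hlam x hδ]
  simp only [add_mul, Finset.sum_add_distrib, mul_assoc, ← Finset.mul_sum]
  ring

/-- the minimum of `f_α` on `[0, minᵢ λᵢ)` is attained at `δ = α/2`. -/
theorem fA_min_at_half_alpha (M P : ℕ) (hM : 0 < M) (hP : 0 < P)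
    (x : Fin M → ℝ)
    (U : Matrix (Fin M) (Fin P) ℝ)
    (hU : Uᵀ * U = (1 : Matrix (Fin P) (Fin P) ℝ))
    (lam : Fin P → ℝ) (hlam : ∀ i, 0 < lam i)
    (α : ℝ) (hα : 0 < α) (hαlam : ∀ i, α < lam i) :
    ∀ δ : ℝ, 0 ≤ δ → (∀ i, δ < lam i) →
      fA U lam x α (α / 2) ≤ fA U lam x α δ := by
  intro δ _ hδ
  rw [fA_eq hU hlam x fun i => (half_lt_self hα).trans (hαlam i), fA_eq hU hlam x hδ]
  have hquad : -(α / 2) + (1 / α) * (α / 2) ^ 2 ≤ -δ + (1 / α) * δ ^ 2 := by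
    have hsq : -δ + (1 / α) * δ ^ 2 - (-(α / 2) + (1 / α) * (α / 2) ^ 2) =
        (1 / α) * (δ - α / 2) ^ 2 := by
      field_simp
      ring
    have hnonneg : 0 ≤ (1 / α) * (δ - α / 2) ^ 2 := by positivity
    linarith
  gcongr ?_ * (?_ + _)
  refine Finset.sum_le_sum fun i _ => mul_le_mul_of_nonneg_right ?_ (sq_nonneg _)
  linarith
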